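/- There exist positive constants l_1, …, l_n and c_n > 0 such that the function V_n is continuously differentiable on ℝ^n ∖ {0}, and for every x ∈ ℝ^n ∖ {0}, every u ∈ ℝ, and every s ∈ [−1, 1] satisfying s = sign(ω_n(x)) whenever ω_n(x) ≠ 0, one has ∇V_n(x)·(J_n x + e_n u) ≤ −c_n V_n(x)^α + ω_n(x)(u + l_n s), where α = 2(n−1)/(2n−1). -/

import Mathlib

open MeasureTheory Filter Matrix

noncomputable section

/-- The signed power `⌊x⌉^a = |x|^a · sign x`. -/
def sgnPow (x a : ℝ) : ℝ := |x| ^ a * Real.sign x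

/-- The exponents `p_i = 1 - (i-1)/n`. -/
def pe (n i : ℕ) : ℝ := 1 - ((i : ℝ) - 1) / n

/-- The exponents `β_0 = p_2`, `β_i = (n-1+i)/(n-i)`. -/
def be (n i : ℕ) : ℝ := if i = 0 then pe n 2 else ((n : ℝ) - 1 + i) / ((n : ℝ) - i)

/-- The exponent `α = 2(n-1)/(2n-1)`. -/
def al (n : ℕ) : ℝ := 2 * ((n : ℝ) - 1) / (2 * (n : ℝ) - 1)

/-- The recursively defined virtual controls `v_i`; states are 1-indexed sequences
(the 0-th coordinate is unused). -/
def vfb (n : ℕ) (l : ℕ → ℝ) : ℕ → (ℕ → ℝ) → ℝ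
  | 0, _ => 0
  | i + 1, x =>
    -l (i + 1) *
      sgnPow (sgnPow (x (i + 1)) (be n i) - sgnPow (vfb n l i x) (be n i))
        (pe n (i + 2) / (pe n (i + 1) * be n i))

/-- `ω_i(x_1,…,x_i) = ⌊x_i⌉^{β_{i-1}} - ⌊v_{i-1}⌉^{β_{i-1}}`. -/
def omfb (n : ℕ) (l : ℕ → ℝ) (i : ℕ) (x : ℕ → ℝ) : ℝ :=
  sgnPow (x i) (be n (i - 1)) - sgnPow (vfb n l (i - 1) x) (be n (i - 1))

/-- `W_i`. -/
def Wfb (n : ℕ) (l : ℕ → ℝ) (i : ℕ) (x : ℕ → ℝ) : ℝ :=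
  (|x i| ^ (be n (i - 1) + 1) - |vfb n l (i - 1) x| ^ (be n (i - 1) + 1)) / (be n (i - 1) + 1) -
    sgnPow (vfb n l (i - 1) x) (be n (i - 1)) * (x i - vfb n l (i - 1) x)

/-- Embedding of `ℝ^n` into 1-indexed sequences. -/
def emb (n : ℕ) (x : Fin n → ℝ) (j : ℕ) : ℝ :=
  if h : 1 ≤ j ∧ j ≤ n then x ⟨j - 1, by omega⟩ else 0

/-- The Lyapunov function `V_n = Σ_{i=1}^n W_i` on `ℝ^n`. -/
def Vn (n : ℕ) (l : ℕ → ℝ) (x : Fin n → ℝ) : ℝ :=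
  ∑ i ∈ Finset.Icc 1 n, Wfb n l i (emb n x)

/-- `ω_n` on `ℝ^n`. -/
def omn (n : ℕ) (l : ℕ → ℝ) (x : Fin n → ℝ) : ℝ := omfb n l n (emb n x)

/-- The `n`-th Jordan block: `(J_n)_{ij} = 1` if `i = j - 1` (1-indexed), else `0`. -/
def Jmat (n : ℕ) : Matrix (Fin n) (Fin n) ℝ :=
  Matrix.of fun i j => if (i : ℕ) + 1 = (j : ℕ) then 1 else 0

/-- The `i`-th standard basis vector of `ℝ^n` (1-indexed: `eVec n n = e_n`). -/
def eVec (n i : ℕ) : Fin n → ℝ := fun j => if (j : ℕ) + 1 = i then 1 else 0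

/-! ### Signed powers -/

theorem sgnPow_eq (x a : ℝ) : sgnPow x a = |x| ^ (a - 1) * x := by
  rcases lt_trichotomy x 0 with h | rfl | h
  · have h' : |x| ≠ 0 := abs_ne_zero.2 h.ne
    rw [sgnPow, Real.sign_of_neg h, Real.rpow_sub_one h', abs_of_neg h]
    have := h.ne
    field_simp
  · simp [sgnPow]
  · have h' : |x| ≠ 0 := abs_ne_zero.2 h.ne'
    rw [sgnPow, Real.sign_of_pos h, Real.rpow_sub_one h', abs_of_pos h]
    field_simp

@[simp] theorem sgnPow_zero_left (a : ℝ) : sgnPow 0 a = 0 := by simp [sgnPow]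

@[simp] theorem sgnPow_one_right (x : ℝ) : sgnPow x 1 = x := by simp [sgnPow_eq]

theorem sgnPow_neg (x a : ℝ) : sgnPow (-x) a = -sgnPow x a := by
  simp [sgnPow_eq]

theorem sgnPow_mul {c : ℝ} (hc : 0 < c) (x a : ℝ) :
    sgnPow (c * x) a = c ^ a * sgnPow x a := by
  rw [sgnPow_eq, sgnPow_eq, abs_mul, abs_of_pos hc, Real.mul_rpow hc.le (abs_nonneg x),
    Real.rpow_sub_one hc.ne']
  field_simp

theorem abs_sgnPow (x : ℝ) {a : ℝ} (ha : 0 < a) : |sgnPow x a| = |x| ^ a := by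
  rcases eq_or_ne x 0 with rfl | h
  · simp [Real.zero_rpow ha.ne']
  · have h' : |x| ≠ 0 := abs_ne_zero.2 h
    rw [sgnPow_eq, abs_mul, Real.rpow_sub_one h', abs_div, abs_abs,
      abs_of_nonneg (Real.rpow_nonneg (abs_nonneg x) a)]
    field_simp

theorem sgnPow_sgnPow (x : ℝ) {a : ℝ} (ha : 0 < a) (b : ℝ) :
    sgnPow (sgnPow x a) b = sgnPow x (a * b) := by
  rcases eq_or_ne x 0 with rfl | h
  · simp
  · have h' : 0 < |x| := abs_pos.2 h
    rw [sgnPow_eq (sgnPow x a), abs_sgnPow x ha, sgnPow_eq x a, sgnPow_eq x (a * b),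
      ← Real.rpow_mul h'.le, ← mul_assoc, ← Real.rpow_add h']
    ring_nf

theorem mul_sgnPow_self (x : ℝ) {a : ℝ} (ha : 0 < a + 1) : x * sgnPow x a = |x| ^ (a + 1) := by
  rcases eq_or_ne x 0 with rfl | h
  · simp [Real.zero_rpow ha.ne']
  · have h' : |x| ≠ 0 := abs_ne_zero.2 h
    rw [sgnPow_eq, Real.rpow_sub_one h', Real.rpow_add_one h']
    field_simp
    rw [sq_abs]

theorem sgnPow_injective {a : ℝ} (ha : 0 < a) : Function.Injective fun x => sgnPow x a := by
  intro x y h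
  have h2 := congrArg (fun z => sgnPow z a⁻¹) h
  simpa [sgnPow_sgnPow _ ha, mul_inv_cancel₀ ha.ne'] using h2

theorem hasDerivAt_abs_rpow_div (x : ℝ) {p : ℝ} (hp : 1 < p) :
    HasDerivAt (fun x : ℝ => |x| ^ p / p) (sgnPow x (p - 1)) x := by
  have hp0 : p ≠ 0 := by positivity
  refine ((hasDerivAt_abs_rpow x hp).div_const p).congr_deriv ?_
  rw [sgnPow_eq]
  field_simp
  ring_nf

theorem contDiff_abs_rpow {p : ℝ} (hp : 1 < p) : ContDiff ℝ 1 fun x : ℝ => |x| ^ p :=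
  contDiff_norm_rpow (E := ℝ) hp

theorem continuous_sgnPow {a : ℝ} (ha : 0 < a) : Continuous fun x => sgnPow x a := by
  have hp : 1 < a + 1 := by linarith
  have h := ((contDiff_abs_rpow hp).div_const (a + 1)).continuous_deriv le_rfl
  have h2 : deriv (fun x : ℝ => |x| ^ (a + 1) / (a + 1)) = fun x => sgnPow x a := by
    funext x
    rw [(hasDerivAt_abs_rpow_div x hp).deriv, add_sub_cancel_right]
  rwa [h2] at h

theorem hasDerivAt_sgnPow (x : ℝ) {a : ℝ} (ha : 1 < a) :
    HasDerivAt (fun x => sgnPow x a) (a * |x| ^ (a - 1)) x := by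
  have hfun : (fun x => sgnPow x a) = fun x => |x| ^ (a - 1) * x := by
    funext y
    exact sgnPow_eq y a
  rw [hfun]
  have ha1 : 0 < a - 1 := by linarith
  rcases eq_or_ne x 0 with rfl | h
  · rw [hasDerivAt_iff_tendsto_slope_zero]
    have hc : Continuous fun t : ℝ => |t| ^ (a - 1) :=
      continuous_abs.rpow_const fun _ => Or.inr ha1.le
    have h0 := (hc.tendsto 0).mono_left (nhdsWithin_le_nhds (s := {0}ᶜ))
    simp only [abs_zero, Real.zero_rpow ha1.ne', mul_zero] at h0 ⊢
    refine h0.congr' ?_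
    filter_upwards [self_mem_nhdsWithin] with t ht
    have ht' : t ≠ 0 := ht
    simp
    field_simp
  · have h' : |x| ≠ 0 := abs_ne_zero.2 h
    have hd := ((hasDerivAt_abs h).rpow_const (p := a - 1) (Or.inl h')).mul (hasDerivAt_id x)
    refine hd.congr_deriv ?_
    have hs : (SignType.sign x : ℝ) * x = |x| := sign_mul_self x
    rw [Real.rpow_sub_one h' (a - 1)]
    simp only [id, mul_one]
    rw [show (SignType.sign x : ℝ) * (a - 1) * (|x| ^ (a - 1) / |x|) * x
      = (SignType.sign x * x) * (a - 1) * (|x| ^ (a - 1) / |x|) by ring, hs]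
    field_simp
    ring

theorem contDiff_sgnPow {a : ℝ} (ha : 1 < a) : ContDiff ℝ 1 fun x => sgnPow x a := by
  rw [contDiff_one_iff_deriv]
  refine ⟨fun x => (hasDerivAt_sgnPow x ha).differentiableAt, ?_⟩
  have h : deriv (fun x => sgnPow x a) = fun x => a * |x| ^ (a - 1) :=
    funext fun x => (hasDerivAt_sgnPow x ha).deriv
  rw [h]
  exact continuous_const.mul (continuous_abs.rpow_const fun _ => Or.inr (by linarith))

/-! ### Exponents -/

/-- The exponent of `ω_{k+1}` in `v_{k+1}`. -/
def vexp (n k : ℕ) : ℝ := pe n (k + 2) / (pe n (k + 1) * be n k)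

/-- The exponent of `ω_{k+1}` in `⌊v_{k+1}⌉^{β_{k+1}}`. -/
def yexp (n k : ℕ) : ℝ := ((n : ℝ) + k) / ((n : ℝ) - 1 + k)

theorem be_eq {n k : ℕ} (hk : k < n) : be n k = ((n : ℝ) - 1 + k) / ((n : ℝ) - k) := by
  have hn : (0 : ℝ) < n := by exact_mod_cast (by omega : 0 < n)
  unfold be
  split_ifs with h
  · subst h
    simp only [pe, Nat.cast_zero, Nat.cast_ofNat, sub_zero, add_zero]
    field_simp
    ring
  · rfl

theorem sub_cast_pos {n k : ℕ} (hk : k < n) : (0 : ℝ) < (n : ℝ) - k :=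
  sub_pos.2 (by exact_mod_cast hk)

theorem cast_sub_one_add_pos {n : ℕ} (hn : 2 ≤ n) (k : ℕ) : (0 : ℝ) < (n : ℝ) - 1 + k := by
  have h1 : (2 : ℝ) ≤ n := by exact_mod_cast hn
  have h2 : (0 : ℝ) ≤ k := k.cast_nonneg
  linarith

theorem be_pos {n k : ℕ} (hn : 2 ≤ n) (hk : k < n) : 0 < be n k := by
  rw [be_eq hk]
  exact div_pos (cast_sub_one_add_pos hn k) (sub_cast_pos hk)

theorem one_lt_be {n k : ℕ} (hk : k + 1 < n) : 1 < be n (k + 1) := by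
  have h := sub_cast_pos hk
  have hk0 : (0 : ℝ) ≤ k := k.cast_nonneg
  rw [be_eq hk, one_lt_div h]
  push_cast
  linarith

theorem vexp_eq {n k : ℕ} (hn : 2 ≤ n) (hk : k < n) :
    vexp n k = ((n : ℝ) - (k + 1)) / ((n : ℝ) - 1 + k) := by
  have h1 := cast_sub_one_add_pos hn k
  have h2 := sub_cast_pos hk
  have h3 : (0 : ℝ) < n := by exact_mod_cast (by omega : 0 < n)
  have h4 : pe n (k + 1) = ((n : ℝ) - k) / n := by
    simp only [pe]
    field_simp
    push_cast
    ring
  have h5 : pe n (k + 2) = ((n : ℝ) - (k + 1)) / n := by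
    simp only [pe]
    field_simp
    push_cast
    ring
  rw [vexp, be_eq hk, h4, h5]
  field_simp

theorem vexp_nonneg {n k : ℕ} (hn : 2 ≤ n) (hk : k < n) : 0 ≤ vexp n k := by
  rw [vexp_eq hn hk]
  have h : (k : ℝ) + 1 ≤ n := by exact_mod_cast hk
  exact div_nonneg (by linarith) (cast_sub_one_add_pos hn k).le

theorem vexp_pos {n k : ℕ} (hn : 2 ≤ n) (hk : k + 1 < n) : 0 < vexp n k := by
  rw [vexp_eq hn (by omega)]
  have h : (k : ℝ) + 1 < n := by exact_mod_cast hk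
  exact div_pos (by linarith) (cast_sub_one_add_pos hn k)

theorem one_lt_yexp {n : ℕ} (hn : 2 ≤ n) (k : ℕ) : 1 < yexp n k := by
  rw [yexp, one_lt_div (cast_sub_one_add_pos hn k)]
  linarith

theorem vexp_mul_be {n k : ℕ} (hn : 2 ≤ n) (hk : k + 1 < n) :
    vexp n k * be n (k + 1) = yexp n k := by
  have h1 := cast_sub_one_add_pos hn k
  have h2 := sub_cast_pos hk
  rw [vexp_eq hn (by omega), be_eq hk, yexp]
  push_cast at h2 ⊢
  field_simp
  ring

theorem al_pos {n : ℕ} (hn : 2 ≤ n) : 0 < al n := by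
  have h1 : (2 : ℝ) ≤ n := by exact_mod_cast hn
  exact div_pos (by linarith) (by linarith)

/-! ### The virtual controls and their derivatives along the chain of integrators -/

/-- The signed powers `⌊v_k⌉^{β_k}`. -/
def yfb (n : ℕ) (l : ℕ → ℝ) (k : ℕ) (x : ℕ → ℝ) : ℝ := sgnPow (vfb n l k x) (be n k)

/-- `ω_k`, with `ω_0 = 0`. -/
def omz (n : ℕ) (l : ℕ → ℝ) : ℕ → (ℕ → ℝ) → ℝ
  | 0, _ => 0
  | k + 1, x => sgnPow (x (k + 1)) (be n k) - yfb n l k x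

/-- The derivative of `⌊v_k⌉^{β_k}` along `x_i' = x_{i+1}`. -/
def dyfb (n : ℕ) (l : ℕ → ℝ) : ℕ → (ℕ → ℝ) → ℝ
  | 0, _ => 0
  | 1, x => -(l 1 ^ be n 1) * x 2
  | k + 2, x =>
    -(l (k + 2) ^ be n (k + 2)) *
      (yexp n (k + 1) * |omz n l (k + 2) x| ^ (yexp n (k + 1) - 1) *
        (be n (k + 1) * |x (k + 2)| ^ (be n (k + 1) - 1) * x (k + 3) - dyfb n l (k + 1) x))

/-- The partial sums `W_1 + ⋯ + W_k`. -/
def Vsum (n : ℕ) (l : ℕ → ℝ) (k : ℕ) (x : ℕ → ℝ) : ℝ :=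
  ∑ i ∈ Finset.range k, Wfb n l (i + 1) x

/-- The derivative of `Vsum n l k` along `x_i' = x_{i+1}`, without the term `ω_k x_k'`. -/
def drift (n : ℕ) (l : ℕ → ℝ) : ℕ → (ℕ → ℝ) → ℝ
  | 0, _ => 0
  | k + 1, x =>
    drift n l k x + omz n l k x * x (k + 1) - (x (k + 1) - vfb n l k x) * dyfb n l k x

section

variable {n : ℕ} {l : ℕ → ℝ}

theorem vfb_succ (k : ℕ) (x : ℕ → ℝ) :
    vfb n l (k + 1) x = -l (k + 1) * sgnPow (omz n l (k + 1) x) (vexp n k) := rfl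

theorem Wfb_succ (k : ℕ) (x : ℕ → ℝ) :
    Wfb n l (k + 1) x = (|x (k + 1)| ^ (be n k + 1) - |vfb n l k x| ^ (be n k + 1)) / (be n k + 1) -
      yfb n l k x * (x (k + 1) - vfb n l k x) := rfl

theorem Vsum_succ (k : ℕ) (x : ℕ → ℝ) :
    Vsum n l (k + 1) x = Vsum n l k x + Wfb n l (k + 1) x :=
  Finset.sum_range_succ _ _

@[simp] theorem yfb_zero (x : ℕ → ℝ) : yfb n l 0 x = 0 := sgnPow_zero_left _

theorem yfb_succ (hn : 2 ≤ n) (hl : ∀ i, 0 < l i) {k : ℕ} (hk : k + 1 < n) (x : ℕ → ℝ) :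
    yfb n l (k + 1) x =
      -(l (k + 1) ^ be n (k + 1)) * sgnPow (omz n l (k + 1) x) (yexp n k) := by
  rw [yfb, vfb_succ, neg_mul, sgnPow_neg, sgnPow_mul (hl _), sgnPow_sgnPow _ (vexp_pos hn hk),
    vexp_mul_be hn hk, neg_mul]

theorem yfb_one (hn : 2 ≤ n) (hl : ∀ i, 0 < l i) (x : ℕ → ℝ) :
    yfb n l 1 x = -(l 1 ^ be n 1) * x 1 := by
  have h1 : (2 : ℝ) ≤ n := by exact_mod_cast hn
  have h2 : (n : ℝ) - 1 ≠ 0 := by linarith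
  have h : be n 0 * yexp n 0 = 1 := by
    rw [be_eq (by omega), yexp]
    simp only [Nat.cast_zero, add_zero, sub_zero]
    field_simp
  rw [yfb_succ hn hl (by omega)]
  simp only [omz, yfb_zero, sub_zero, zero_add]
  rw [sgnPow_sgnPow _ (be_pos hn (by omega)), h, sgnPow_one_right]

theorem sgnPow_yfb (hn : 2 ≤ n) {k : ℕ} (hk : k < n) (x : ℕ → ℝ) :
    sgnPow (yfb n l k x) (be n k)⁻¹ = vfb n l k x := by
  have h := be_pos hn hk
  rw [yfb, sgnPow_sgnPow _ h, mul_inv_cancel₀ h.ne', sgnPow_one_right]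

/-- `W_{k+1}` as the defect in Young's inequality. -/
theorem Wfb_succ_eq_young (hn : 2 ≤ n) {k : ℕ} (hk : k < n) (x : ℕ → ℝ) :
    Wfb n l (k + 1) x = |x (k + 1)| ^ (be n k + 1) / (be n k + 1) +
      |yfb n l k x| ^ ((be n k)⁻¹ + 1) / ((be n k)⁻¹ + 1) - x (k + 1) * yfb n l k x := by
  have h := be_pos hn hk
  have h1 : |yfb n l k x| ^ ((be n k)⁻¹ + 1) = |vfb n l k x| ^ (be n k + 1) := by
    rw [yfb, abs_sgnPow _ h, ← Real.rpow_mul (abs_nonneg _)]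
    congr 1
    field_simp
    ring
  have h2 : vfb n l k x * yfb n l k x = |vfb n l k x| ^ (be n k + 1) :=
    mul_sgnPow_self _ (by linarith)
  rw [Wfb_succ, h1, mul_sub, mul_comm _ (vfb n l k x), h2]
  field_simp
  ring

theorem Wfb_succ_nonneg (hn : 2 ≤ n) {k : ℕ} (hk : k < n) (x : ℕ → ℝ) :
    0 ≤ Wfb n l (k + 1) x := by
  have h := be_pos hn hk
  have hc : (be n k + 1).HolderConjugate ((be n k)⁻¹ + 1) := by
    rw [Real.holderConjugate_iff]
    refine ⟨by linarith, ?_⟩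
    field_simp
    ring
  rw [Wfb_succ_eq_young hn hk, sub_nonneg]
  exact Real.young_inequality _ _ hc

theorem Vsum_nonneg (hn : 2 ≤ n) {k : ℕ} (hk : k ≤ n) (x : ℕ → ℝ) : 0 ≤ Vsum n l k x :=
  Finset.sum_nonneg fun i hi =>
    Wfb_succ_nonneg hn (by have := Finset.mem_range.1 hi; omega) x

/-! #### Dependence on the first coordinates and gains -/

theorem vfb_congr {l' : ℕ → ℝ} {x x' : ℕ → ℝ} : ∀ {k : ℕ}, (∀ i ∈ Finset.Icc 1 k, l i = l' i) →
    (∀ i ∈ Finset.Icc 1 k, x i = x' i) → vfb n l k x = vfb n l' k x'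
  | 0, _, _ => rfl
  | k + 1, hl, hx => by
    have hsub : Finset.Icc 1 k ⊆ Finset.Icc 1 (k + 1) := Finset.Icc_subset_Icc_right (by omega)
    have ih := vfb_congr (fun i hi => hl i (hsub hi)) (fun i hi => hx i (hsub hi))
    have hm : k + 1 ∈ Finset.Icc 1 (k + 1) := Finset.mem_Icc.2 ⟨by omega, le_rfl⟩
    simp only [vfb, ih, hl _ hm, hx _ hm]

theorem yfb_congr {l' : ℕ → ℝ} {x x' : ℕ → ℝ} {k : ℕ} (hl : ∀ i ∈ Finset.Icc 1 k, l i = l' i)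
    (hx : ∀ i ∈ Finset.Icc 1 k, x i = x' i) : yfb n l k x = yfb n l' k x' := by
  rw [yfb, yfb, vfb_congr hl hx]

theorem omz_congr {l' : ℕ → ℝ} {x x' : ℕ → ℝ} : ∀ {k : ℕ},
    (∀ i ∈ Finset.Icc 1 (k - 1), l i = l' i) → (∀ i ∈ Finset.Icc 1 k, x i = x' i) →
    omz n l k x = omz n l' k x'
  | 0, _, _ => rfl
  | k + 1, hl, hx => by
    have hsub : Finset.Icc 1 k ⊆ Finset.Icc 1 (k + 1) := Finset.Icc_subset_Icc_right (by omega)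
    rw [omz, omz, yfb_congr (k := k) hl fun i hi => hx i (hsub hi),
      hx _ (Finset.mem_Icc.2 ⟨by omega, le_rfl⟩)]

theorem Wfb_succ_congr {l' : ℕ → ℝ} {x x' : ℕ → ℝ} {k : ℕ}
    (hl : ∀ i ∈ Finset.Icc 1 k, l i = l' i) (hx : ∀ i ∈ Finset.Icc 1 (k + 1), x i = x' i) :
    Wfb n l (k + 1) x = Wfb n l' (k + 1) x' := by
  have hsub : Finset.Icc 1 k ⊆ Finset.Icc 1 (k + 1) := Finset.Icc_subset_Icc_right (by omega)
  have hx' := fun i hi => hx i (hsub hi)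
  rw [Wfb_succ, Wfb_succ, yfb_congr hl hx', vfb_congr hl hx',
    hx _ (Finset.mem_Icc.2 ⟨by omega, le_rfl⟩)]

theorem Vsum_congr {l' : ℕ → ℝ} {x x' : ℕ → ℝ} {k : ℕ}
    (hl : ∀ i ∈ Finset.Icc 1 (k - 1), l i = l' i) (hx : ∀ i ∈ Finset.Icc 1 k, x i = x' i) :
    Vsum n l k x = Vsum n l' k x' := by
  refine Finset.sum_congr rfl fun j hj => ?_
  have hj' := Finset.mem_range.1 hj
  exact Wfb_succ_congr (fun i hi => hl i (Finset.Icc_subset_Icc_right (by omega) hi))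
    fun i hi => hx i (Finset.Icc_subset_Icc_right (by omega) hi)

theorem dyfb_congr {l' : ℕ → ℝ} {x x' : ℕ → ℝ} : ∀ {k : ℕ},
    (∀ i ∈ Finset.Icc 1 k, l i = l' i) → (∀ i ∈ Finset.Icc 1 (k + 1), x i = x' i) →
    dyfb n l k x = dyfb n l' k x'
  | 0, _, _ => rfl
  | 1, hl, hx => by simp [dyfb, hl 1 (by simp), hx 2 (by simp)]
  | k + 2, hl, hx => by
    have ih := dyfb_congr (k := k + 1)
      (fun i hi => hl i (Finset.Icc_subset_Icc_right (by omega) hi))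
      (fun i hi => hx i (Finset.Icc_subset_Icc_right (by omega) hi))
    have ho : omz n l (k + 2) x = omz n l' (k + 2) x' :=
      omz_congr (fun i hi => hl i (Finset.Icc_subset_Icc_right (by omega) hi))
        (fun i hi => hx i (Finset.Icc_subset_Icc_right (by omega) hi))
    simp only [dyfb]
    rw [ih, ho, hl (k + 2) (by simp), hx (k + 2) (by simp), hx (k + 3) (by simp)]

theorem drift_congr {l' : ℕ → ℝ} {x : ℕ → ℝ} : ∀ {k : ℕ},
    (∀ i ∈ Finset.Icc 1 (k - 1), l i = l' i) → drift n l k x = drift n l' k x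
  | 0, _ => rfl
  | k + 1, hl => by
    have hl' : ∀ i ∈ Finset.Icc 1 (k - 1), l i = l' i :=
      fun i hi => hl i (Finset.Icc_subset_Icc_right (by omega) hi)
    simp only [drift]
    rw [drift_congr hl', omz_congr hl' fun _ _ => rfl, vfb_congr (k := k) hl fun _ _ => rfl,
      dyfb_congr (k := k) hl fun _ _ => rfl]

/-! #### Continuity -/

theorem continuous_vfb (hn : 2 ≤ n) : ∀ {k : ℕ}, k < n → Continuous (vfb n l k)
  | 0, _ => continuous_const
  | k + 1, hk => by
    have ih := continuous_vfb hn (k := k) (by omega)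
    have hb := continuous_sgnPow (be_pos hn (k := k) (by omega))
    have ho : Continuous (omz n l (k + 1)) :=
      (hb.comp (continuous_apply (k + 1))).sub (hb.comp ih)
    exact continuous_const.mul ((continuous_sgnPow (vexp_pos hn hk)).comp ho)

theorem continuous_yfb (hn : 2 ≤ n) {k : ℕ} (hk : k < n) : Continuous (yfb n l k) :=
  (continuous_sgnPow (be_pos hn hk)).comp (continuous_vfb hn hk)

theorem continuous_omz (hn : 2 ≤ n) : ∀ {k : ℕ}, k ≤ n → Continuous (omz n l k)
  | 0, _ => continuous_const
  | k + 1, hk => ((continuous_sgnPow (be_pos hn (k := k) (by omega))).comp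
      (continuous_apply (k + 1))).sub (continuous_yfb hn (by omega))

theorem continuous_dyfb (hn : 2 ≤ n) : ∀ {k : ℕ}, k < n → Continuous (dyfb n l k)
  | 0, _ => continuous_const
  | 1, _ => continuous_const.mul (continuous_apply 2)
  | k + 2, hk => by
    have ih := continuous_dyfb hn (k := k + 1) (by omega)
    have ho : Continuous fun x => |omz n l (k + 2) x| ^ (yexp n (k + 1) - 1) :=
      (continuous_omz hn hk.le).abs.rpow_const
        fun _ => Or.inr (sub_nonneg.2 (one_lt_yexp hn _).le)
    have hx : Continuous fun x : ℕ → ℝ => |x (k + 2)| ^ (be n (k + 1) - 1) :=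
      (continuous_apply (k + 2)).abs.rpow_const
        fun _ => Or.inr (sub_nonneg.2 (one_lt_be (by omega)).le)
    exact continuous_const.mul ((continuous_const.mul ho).mul
      (((continuous_const.mul hx).mul (continuous_apply (k + 3))).sub ih))

theorem continuous_Vsum (hn : 2 ≤ n) {k : ℕ} (hk : k ≤ n) : Continuous (Vsum n l k) := by
  refine continuous_finsetSum _ fun i hi => ?_
  have hi' : i < n := by
    have := Finset.mem_range.1 hi
    omega
  have hb := be_pos hn hi'
  have hx : Continuous fun x : ℕ → ℝ => |x (i + 1)| ^ (be n i + 1) :=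
    (continuous_apply (i + 1)).abs.rpow_const fun _ => Or.inr (by linarith)
  have hv : Continuous fun x => |vfb n l i x| ^ (be n i + 1) :=
    (continuous_vfb hn hi').abs.rpow_const fun _ => Or.inr (by linarith)
  exact ((hx.sub hv).div_const _).sub
    ((continuous_yfb hn hi').mul ((continuous_apply (i + 1)).sub (continuous_vfb hn hi')))

/-! #### Weighted homogeneity -/

/-- The weighted dilation `x_i ↦ t^{n+1-i} x_i`. -/
def dil (n : ℕ) (t : ℝ) (x : ℕ → ℝ) (i : ℕ) : ℝ := t ^ ((n : ℝ) + 1 - i) * x i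

theorem sgnPow_rpow_mul {t : ℝ} (ht : 0 < t) {a d e : ℝ} (h : d * a = e) (z : ℝ) :
    sgnPow (t ^ d * z) a = t ^ e * sgnPow z a := by
  rw [sgnPow_mul (Real.rpow_pos_of_pos ht d), ← Real.rpow_mul ht.le, h]

theorem abs_rpow_mul_rpow {t : ℝ} (ht : 0 < t) {a d e : ℝ} (h : d * a = e) (z : ℝ) :
    |t ^ d * z| ^ a = t ^ e * |z| ^ a := by
  have hp := Real.rpow_pos_of_pos ht d
  rw [abs_mul, abs_of_pos hp, Real.mul_rpow hp.le (abs_nonneg z), ← Real.rpow_mul ht.le, h]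

theorem sub_mul_be {k : ℕ} (hk : k < n) : ((n : ℝ) - k) * be n k = (n : ℝ) - 1 + k := by
  have h := sub_cast_pos hk
  rw [be_eq hk]
  field_simp

theorem dil_succ (t : ℝ) (x : ℕ → ℝ) (k : ℕ) :
    dil n t x (k + 1) = t ^ ((n : ℝ) - k) * x (k + 1) := by
  rw [dil]
  push_cast
  ring_nf

theorem vfb_dil (hn : 2 ≤ n) {t : ℝ} (ht : 0 < t) (x : ℕ → ℝ) : ∀ {k : ℕ}, k ≤ n →
    vfb n l k (dil n t x) = t ^ ((n : ℝ) - k) * vfb n l k x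
  | 0, _ => by simp [vfb]
  | k + 1, hk => by
    have hk' : k < n := hk
    have ih := vfb_dil hn ht x hk'.le
    have hd := cast_sub_one_add_pos hn k
    have ho : omz n l (k + 1) (dil n t x) = t ^ ((n : ℝ) - 1 + k) * omz n l (k + 1) x := by
      simp only [omz, yfb]
      rw [ih, dil_succ, sgnPow_rpow_mul ht (sub_mul_be hk'), sgnPow_rpow_mul ht (sub_mul_be hk'),
        mul_sub]
    have he : ((n : ℝ) - 1 + k) * vexp n k = (n : ℝ) - (k + 1 : ℕ) := by
      rw [vexp_eq hn hk']
      push_cast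
      field_simp
    rw [vfb_succ, vfb_succ, ho, sgnPow_rpow_mul ht he]
    ring

theorem yfb_dil (hn : 2 ≤ n) {t : ℝ} (ht : 0 < t) (x : ℕ → ℝ) {k : ℕ} (hk : k < n) :
    yfb n l k (dil n t x) = t ^ ((n : ℝ) - 1 + k) * yfb n l k x := by
  rw [yfb, vfb_dil hn ht x hk.le, sgnPow_rpow_mul ht (sub_mul_be hk), yfb]

theorem omz_succ_dil (hn : 2 ≤ n) {t : ℝ} (ht : 0 < t) (x : ℕ → ℝ) {k : ℕ} (hk : k < n) :
    omz n l (k + 1) (dil n t x) = t ^ ((n : ℝ) - 1 + k) * omz n l (k + 1) x := by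
  simp only [omz]
  rw [yfb_dil hn ht x hk, dil_succ, sgnPow_rpow_mul ht (sub_mul_be hk), mul_sub]

theorem omz_dil (hn : 2 ≤ n) {t : ℝ} (ht : 0 < t) (x : ℕ → ℝ) : ∀ {k : ℕ}, k ≤ n →
    omz n l k (dil n t x) = t ^ ((n : ℝ) - 2 + k) * omz n l k x
  | 0, _ => by simp [omz]
  | k + 1, hk => by
    rw [omz_succ_dil hn ht x hk]
    congr 2
    push_cast
    ring

theorem dyfb_dil (hn : 2 ≤ n) {t : ℝ} (ht : 0 < t) (x : ℕ → ℝ) : ∀ {k : ℕ}, k < n →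
    dyfb n l k (dil n t x) = t ^ ((n : ℝ) - 2 + k) * dyfb n l k x
  | 0, _ => by simp [dyfb]
  | 1, _ => by
    simp only [dyfb]
    rw [dil_succ, show (n : ℝ) - 2 + (1 : ℕ) = n - (1 : ℕ) by push_cast; ring]
    ring
  | k + 2, hk => by
    have ih := dyfb_dil hn ht x (k := k + 1) (by omega)
    have hd := cast_sub_one_add_pos hn (k + 1)
    have hs := sub_cast_pos (show k + 1 < n by omega)
    have hy : ((n : ℝ) - 1 + (k + 1 : ℕ)) * (yexp n (k + 1) - 1) = 1 := by
      rw [yexp]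
      field_simp
      ring
    have hb : ((n : ℝ) - (k + 1 : ℕ)) * (be n (k + 1) - 1) = 2 * k + 1 := by
      rw [mul_sub, sub_mul_be (by omega)]
      push_cast
      ring
    have h1 : t ^ ((n : ℝ) - 2 + (k + 1 : ℕ)) = t ^ (2 * (k : ℝ) + 1) * t ^ ((n : ℝ) - (k + 2 : ℕ)) := by
      rw [← Real.rpow_add ht]
      congr 1
      push_cast
      ring
    have h2 : t ^ ((n : ℝ) - 2 + (k + 2 : ℕ)) =
        t ^ (1 : ℝ) * (t ^ (2 * (k : ℝ) + 1) * t ^ ((n : ℝ) - (k + 2 : ℕ))) := by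
      rw [← Real.rpow_add ht, ← Real.rpow_add ht]
      congr 1
      push_cast
      ring
    simp only [dyfb]
    rw [ih, omz_succ_dil hn ht x (by omega), dil_succ, dil_succ, abs_rpow_mul_rpow ht hy,
      abs_rpow_mul_rpow ht hb, h1, h2]
    ring

theorem Vsum_dil (hn : 2 ≤ n) {t : ℝ} (ht : 0 < t) (x : ℕ → ℝ) {k : ℕ} (hk : k ≤ n) :
    Vsum n l k (dil n t x) = t ^ (2 * (n : ℝ) - 1) * Vsum n l k x := by
  rw [Vsum, Vsum, Finset.mul_sum]
  refine Finset.sum_congr rfl fun i hi => ?_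
  have hi' : i < n := by
    have := Finset.mem_range.1 hi
    omega
  have he : ((n : ℝ) - i) * (be n i + 1) = 2 * n - 1 := by
    rw [mul_add, sub_mul_be hi']
    ring
  have h1 : t ^ (2 * (n : ℝ) - 1) = t ^ ((n : ℝ) - 1 + i) * t ^ ((n : ℝ) - i) := by
    rw [← Real.rpow_add ht]
    congr 1
    ring
  rw [Wfb_succ, Wfb_succ, yfb_dil hn ht x hi', vfb_dil hn ht x hi'.le, dil_succ,
    abs_rpow_mul_rpow ht he, abs_rpow_mul_rpow ht he, h1]
  ring

theorem Vsum_rpow_al_dil (hn : 2 ≤ n) {t : ℝ} (ht : 0 < t) (x : ℕ → ℝ) {k : ℕ} (hk : k ≤ n) :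
    Vsum n l k (dil n t x) ^ al n = t ^ (2 * (n : ℝ) - 2) * Vsum n l k x ^ al n := by
  have h1 : (2 : ℝ) ≤ n := by exact_mod_cast hn
  have h2 : 2 * (n : ℝ) - 1 ≠ 0 := by linarith
  rw [Vsum_dil hn ht x hk, Real.mul_rpow (Real.rpow_nonneg ht.le _) (Vsum_nonneg hn hk x),
    ← Real.rpow_mul ht.le, al]
  congr 2
  field_simp

theorem omz_mul_vfb_succ (hn : 2 ≤ n) {k : ℕ} (hk : k < n) (x : ℕ → ℝ) :
    omz n l (k + 1) x * vfb n l (k + 1) x =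
      -l (k + 1) * |omz n l (k + 1) x| ^ (vexp n k + 1) := by
  have h := vexp_nonneg hn hk
  rw [vfb_succ, ← mul_sgnPow_self _ (by linarith)]
  ring

theorem abs_omz_succ_rpow_dil (hn : 2 ≤ n) {t : ℝ} (ht : 0 < t) (x : ℕ → ℝ) {k : ℕ}
    (hk : k < n) : |omz n l (k + 1) (dil n t x)| ^ (vexp n k + 1) =
      t ^ (2 * (n : ℝ) - 2) * |omz n l (k + 1) x| ^ (vexp n k + 1) := by
  have hd := cast_sub_one_add_pos hn k
  rw [omz_succ_dil hn ht x hk]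
  refine abs_rpow_mul_rpow ht ?_ _
  rw [vexp_eq hn hk]
  field_simp
  ring

/-- The homogeneous unit sphere in the coordinates `x_1, …, x_m`. -/
def homSphere (m : ℕ) : Set (ℕ → ℝ) :=
  (Set.univ.pi fun i => if i ∈ Finset.Icc 1 m then Set.Icc (-1) 1 else {0}) ∩
    ⋃ i ∈ Finset.Icc 1 m, {x | |x i| = 1}

theorem isCompact_homSphere (m : ℕ) : IsCompact (homSphere m) := by
  refine IsCompact.inter_right (isCompact_univ_pi fun i => ?_) ?_
  · split_ifs
    exacts [isCompact_Icc, isCompact_singleton]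
  · exact isClosed_biUnion_finset fun i _ =>
      isClosed_eq (continuous_apply i).abs continuous_const

theorem exists_dil_homSphere {m : ℕ} (hm : m ≤ n) {x : ℕ → ℝ}
    (hx : ∃ i ∈ Finset.Icc 1 m, x i ≠ 0) :
    ∃ t > 0, ∃ z ∈ homSphere m, ∀ i ∈ Finset.Icc 1 m, x i = dil n t z i := by
  obtain ⟨i₀, hi₀, hx₀⟩ := hx
  obtain ⟨j, hj, hmax⟩ := Finset.exists_max_image (Finset.Icc 1 m)
    (fun i => |x i| ^ ((n : ℝ) + 1 - i)⁻¹) ⟨i₀, hi₀⟩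
  have hw : ∀ i ∈ Finset.Icc 1 m, (0 : ℝ) < (n : ℝ) + 1 - i := fun i hi => by
    have h : (i : ℝ) ≤ n := by exact_mod_cast (Finset.mem_Icc.1 hi).2.trans hm
    linarith
  set t := |x j| ^ ((n : ℝ) + 1 - j)⁻¹ with ht
  have htpos : 0 < t := (Real.rpow_pos_of_pos (abs_pos.2 hx₀) _).trans_le (hmax i₀ hi₀)
  have hle : ∀ i ∈ Finset.Icc 1 m, |x i| ≤ t ^ ((n : ℝ) + 1 - i) := fun i hi => by
    have h := Real.rpow_le_rpow (Real.rpow_nonneg (abs_nonneg _) _) (hmax i hi) (hw i hi).le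
    rwa [Real.rpow_inv_rpow (abs_nonneg _) (hw i hi).ne'] at h
  refine ⟨t, htpos, fun i => if i ∈ Finset.Icc 1 m then x i / t ^ ((n : ℝ) + 1 - i) else 0,
    ⟨fun i _ => ?_, ?_⟩, fun i hi => ?_⟩
  · have hp := Real.rpow_pos_of_pos htpos ((n : ℝ) + 1 - i)
    by_cases hi : i ∈ Finset.Icc 1 m
    · simp only [if_pos hi]
      rw [Set.mem_Icc, ← abs_le, abs_div, abs_of_pos hp]
      exact (div_le_one hp).2 (hle i hi)
    · simp only [if_neg hi, Set.mem_singleton_iff]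
  · refine Set.mem_biUnion hj ?_
    have hp := Real.rpow_pos_of_pos htpos ((n : ℝ) + 1 - j)
    simp only [Set.mem_ofPred_eq, if_pos hj]
    rw [abs_div, abs_of_pos hp, div_eq_one_iff_eq hp.ne', ht,
      Real.rpow_inv_rpow (abs_nonneg _) (hw j hj).ne']
  · have hp := Real.rpow_pos_of_pos htpos ((n : ℝ) + 1 - i)
    simp only [dil, if_pos hi]
    field_simp

/-- A homogeneous function which is nonpositive on the homogeneous sphere is nonpositive. -/
theorem nonpos_of_nonpos_homSphere {m : ℕ} (hm : m ≤ n) {G : (ℕ → ℝ) → ℝ} {d : ℝ} (hd : 0 < d)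
    (hG : ∀ x x', (∀ i ∈ Finset.Icc 1 m, x i = x' i) → G x = G x')
    (hdil : ∀ t > 0, ∀ x, G (dil n t x) = t ^ d * G x) (hS : ∀ x ∈ homSphere m, G x ≤ 0)
    (x : ℕ → ℝ) : G x ≤ 0 := by
  by_cases hx : ∃ i ∈ Finset.Icc 1 m, x i ≠ 0
  · obtain ⟨t, ht, z, hz, hxz⟩ := exists_dil_homSphere hm hx
    rw [hG _ _ hxz, hdil t ht]
    exact mul_nonpos_of_nonneg_of_nonpos (Real.rpow_nonneg ht.le _) (hS z hz)
  · push Not at hx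
    have h0 : dil n 2 0 = 0 := by
      funext i
      simp [dil]
    have h1 := hdil 2 two_pos 0
    rw [h0] at h1
    have h2 : (1 : ℝ) < 2 ^ d := Real.one_lt_rpow one_lt_two hd
    have h3 : G 0 = 0 := by
      have h4 : (2 ^ d - 1) * G 0 = 0 := by linarith
      exact (mul_eq_zero.1 h4).resolve_left (by linarith)
    rw [hG x 0 hx, h3]

theorem exists_mul_le_add_mul {X : Type*} [TopologicalSpace X] {K : Set X} (hK : IsCompact K)
    {f g h : X → ℝ} (hf : Continuous f) (hg : Continuous g) (hh : Continuous h)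
    (hg0 : ∀ x, 0 ≤ g x) (hpos : ∀ x ∈ K, g x = 0 → 0 < f x) :
    ∃ L > 0, ∃ c > 0, ∀ x ∈ K, c * h x ≤ f x + L * g x := by
  obtain ⟨N, hN⟩ := hK.elim_directed_cover (fun N : ℕ => {x | 0 < f x + (N + 1 : ℝ) * g x})
    (fun N => isOpen_lt continuous_const (hf.add (continuous_const.mul hg)))
    (fun x hx => by
      rw [Set.mem_iUnion]
      rcases (hg0 x).eq_or_lt with h0 | h0
      · exact ⟨0, by simpa [← h0] using hpos x hx h0.symm⟩
      · obtain ⟨N, hN⟩ := exists_nat_gt (-f x / g x)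
        rw [div_lt_iff₀ h0] at hN
        refine ⟨N, ?_⟩
        simp only [Set.mem_ofPred_eq]
        nlinarith)
    (directed_of_isDirected_le fun i j hij x hx => by
      have h1 : (i : ℝ) ≤ j := by exact_mod_cast hij
      simp only [Set.mem_ofPred_eq] at hx ⊢
      nlinarith [mul_le_mul_of_nonneg_right h1 (hg0 x)])
  refine ⟨N + 1, by positivity, ?_⟩
  rcases K.eq_empty_or_nonempty with rfl | hne
  · exact ⟨1, one_pos, fun x hx => hx.elim⟩
  obtain ⟨a, ha, hmin⟩ := hK.exists_isMinOn hne
    (hf.add (continuous_const (y := (N + 1 : ℝ)) |>.mul hg)).continuousOn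
  obtain ⟨b, hb, hmax⟩ := hK.exists_isMaxOn hne hh.continuousOn
  have hapos : 0 < f a + (N + 1 : ℝ) * g a := hN ha
  refine ⟨(f a + (N + 1 : ℝ) * g a) / (|h b| + 1), by positivity, fun x hx => ?_⟩
  have h1 : f a + (N + 1 : ℝ) * g a ≤ f x + (N + 1 : ℝ) * g x := hmin hx
  have h2 : h x ≤ h b := hmax hx
  have h3 := le_abs_self (h b)
  rw [div_mul_eq_mul_div, div_le_iff₀ (by positivity)]
  have h4 : h x ≤ |h b| + 1 := by linarith
  calc _ ≤ (f a + (N + 1 : ℝ) * g a) * (|h b| + 1) := mul_le_mul_of_nonneg_left h4 hapos.le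
    _ ≤ _ := mul_le_mul_of_nonneg_right h1 (by positivity)

theorem vfb_eq_zero {x : ℕ → ℝ} {k : ℕ} (hx : ∀ i ∈ Finset.Icc 1 k, x i = 0) :
    vfb n l k x = 0 := by
  induction k with
  | zero => rfl
  | succ k ih =>
    have h := ih fun i hi => hx i (Finset.Icc_subset_Icc_right (by omega) hi)
    simp [vfb, h, hx (k + 1) (by simp)]

theorem eq_zero_of_Vsum_eq_zero (hn : 2 ≤ n) {x : ℕ → ℝ} : ∀ {k : ℕ}, k ≤ n →
    Vsum n l k x = 0 → ∀ i ∈ Finset.Icc 1 k, x i = 0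
  | 0, _, _, i, hi => by simp at hi
  | k + 1, hk, hV, i, hi => by
    rw [Vsum_succ] at hV
    have h1 := Vsum_nonneg (l := l) hn (by omega : k ≤ n) x
    have h2 := Wfb_succ_nonneg (l := l) hn hk x
    have h3 : Vsum n l k x = 0 := by linarith
    have ih := eq_zero_of_Vsum_eq_zero hn (by omega) h3
    have hb := be_pos hn hk
    rcases Nat.lt_or_ge k i with hlt | hge
    · obtain rfl : i = k + 1 := by
        have := (Finset.mem_Icc.1 hi).2
        omega
      have h4 : Wfb n l (k + 1) x = 0 := by linarith
      rw [Wfb_succ, yfb, vfb_eq_zero ih] at h4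
      have hb' : be n k + 1 ≠ 0 := by linarith
      simpa [Real.zero_rpow hb', hb', Real.rpow_eq_zero (abs_nonneg (x (k + 1))) hb'] using h4
    · exact ih i (Finset.mem_Icc.2 ⟨(Finset.mem_Icc.1 hi).1, hge⟩)

/-! ### Choice of the gains -/

theorem exists_gains (hn : 2 ≤ n) : ∀ {k : ℕ}, k ≤ n →
    ∃ l : ℕ → ℝ, (∀ i, 0 < l i) ∧ ∃ c > 0, ∀ x,
      drift n l k x + omz n l k x * vfb n l k x ≤ -c * Vsum n l k x ^ al n
  | 0, _ => ⟨fun _ => 1, fun _ => one_pos, 1, one_pos, fun x => by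
      simp [drift, omz, Vsum, Real.zero_rpow (al_pos hn).ne']⟩
  | k + 1, hk => by
    have hk' : k < n := hk
    have h2n : (2 : ℝ) ≤ n := by exact_mod_cast hn
    obtain ⟨l, hl, c, hc, hle⟩ := exists_gains hn hk'.le
    have hgexp : 0 < vexp n k + 1 := by linarith [vexp_nonneg hn hk']
    let f : (ℕ → ℝ) → ℝ := fun x => c * Vsum n l k x ^ al n -
      (x (k + 1) - vfb n l k x) * (omz n l k x - dyfb n l k x)
    let g : (ℕ → ℝ) → ℝ := fun x => |omz n l (k + 1) x| ^ (vexp n k + 1)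
    let h : (ℕ → ℝ) → ℝ := fun x => Vsum n l (k + 1) x ^ al n
    have hf : Continuous f :=
      (continuous_const.mul ((continuous_Vsum hn hk'.le).rpow_const
        fun _ => Or.inr (al_pos hn).le)).sub
      (((continuous_apply (k + 1)).sub (continuous_vfb hn hk')).mul
        ((continuous_omz hn hk'.le).sub (continuous_dyfb hn hk')))
    have hg : Continuous g := (continuous_omz hn hk).abs.rpow_const fun _ => Or.inr hgexp.le
    have hh : Continuous h :=
      (continuous_Vsum hn hk).rpow_const fun _ => Or.inr (al_pos hn).le
    have hpos : ∀ x ∈ homSphere (k + 1), g x = 0 → 0 < f x := by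
      intro x hx hgx
      have ho : omz n l (k + 1) x = 0 :=
        abs_eq_zero.1 ((Real.rpow_eq_zero (abs_nonneg _) hgexp.ne').1 hgx)
      have hxv : x (k + 1) = vfb n l k x := sgnPow_injective (be_pos hn hk') (sub_eq_zero.1 ho)
      have hV : 0 < Vsum n l k x := by
        refine (Vsum_nonneg hn hk'.le x).lt_of_ne fun h0 => ?_
        have hz := eq_zero_of_Vsum_eq_zero hn hk'.le h0.symm
        obtain ⟨i, hi, hxi⟩ := Set.mem_iUnion₂.1 hx.2
        have hxi' : |x i| = 1 := hxi
        have hi' := Finset.mem_Icc.1 hi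
        have : x i = 0 := by
          rcases Nat.lt_or_ge k i with hlt | hge
          · obtain rfl : i = k + 1 := by omega
            rw [hxv, vfb_eq_zero hz]
          · exact hz i (Finset.mem_Icc.2 ⟨hi'.1, hge⟩)
        simp [this] at hxi'
      simp only [f, hxv, sub_self, zero_mul, sub_zero]
      exact mul_pos hc (Real.rpow_pos_of_pos hV _)
    obtain ⟨L, hL, c', hc', hS⟩ := exists_mul_le_add_mul (isCompact_homSphere (k + 1)) hf hg hh
      (fun x => Real.rpow_nonneg (abs_nonneg _) _) hpos
    have hall : ∀ x, c' * h x - (f x + L * g x) ≤ 0 := by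
      refine nonpos_of_nonpos_homSphere hk (d := 2 * (n : ℝ) - 2) (by linarith) ?_ ?_
        fun x hx => sub_nonpos.2 (hS x hx)
      · intro x x' hxx
        have hxx' : ∀ i ∈ Finset.Icc 1 k, x i = x' i :=
          fun i hi => hxx i (Finset.Icc_subset_Icc_right (by omega) hi)
        have hrfl : ∀ m, ∀ i ∈ Finset.Icc 1 m, l i = l i := fun _ _ _ => rfl
        simp only [f, g, h]
        rw [Vsum_congr (hrfl _) hxx, Vsum_congr (hrfl _) hxx', vfb_congr (hrfl _) hxx',
          omz_congr (hrfl _) hxx', omz_congr (hrfl _) hxx, dyfb_congr (hrfl _) hxx,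
          hxx (k + 1) (by simp)]
      · intro t ht x
        have hexp : t ^ (2 * (n : ℝ) - 2) = t ^ ((n : ℝ) - k) * t ^ ((n : ℝ) - 2 + k) := by
          rw [← Real.rpow_add ht]
          congr 1
          ring
        simp only [f, g, h]
        rw [Vsum_rpow_al_dil hn ht x hk, Vsum_rpow_al_dil hn ht x hk'.le,
          abs_omz_succ_rpow_dil hn ht x hk', vfb_dil hn ht x hk'.le, omz_dil hn ht x hk'.le,
          dyfb_dil hn ht x hk', dil_succ, hexp]
        ring
    refine ⟨Function.update l (k + 1) L, fun i => ?_, c', hc', fun x => ?_⟩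
    · rcases eq_or_ne i (k + 1) with rfl | hi
      · simpa using hL
      · simpa [hi] using hl i
    · have hupd : ∀ i ∈ Finset.Icc 1 (k + 1 - 1), Function.update l (k + 1) L i = l i := by
        intro i hi
        have := Finset.mem_Icc.1 hi
        exact Function.update_of_ne (by omega) _ _
      have h1 := hle x
      have h2 := hall x
      rw [omz_mul_vfb_succ hn hk', drift_congr hupd, omz_congr hupd fun _ _ => rfl,
        Vsum_congr hupd fun _ _ => rfl, Function.update_self]
      simp only [f, g, h] at h2
      simp only [drift]
      linarith

/-! ### Derivatives -/

theorem hasDerivAt_yfb (hn : 2 ≤ n) (hl : ∀ i, 0 < l i) {γ : ℝ → ℕ → ℝ} {s : ℝ}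
    (hγ : ∀ i, 1 ≤ i → i < n → HasDerivAt (fun t => γ t i) (γ s (i + 1)) s) :
    ∀ {k : ℕ}, k < n → HasDerivAt (fun t => yfb n l k (γ t)) (dyfb n l k (γ s)) s
  | 0, _ => by simpa [dyfb] using hasDerivAt_const s (0 : ℝ)
  | 1, hk => by
    simp only [yfb_one hn hl]
    exact (hγ 1 le_rfl hk).const_mul _
  | k + 2, hk => by
    have ih := hasDerivAt_yfb hn hl hγ (k := k + 1) (by omega)
    have hx := (hasDerivAt_sgnPow (γ s (k + 2)) (one_lt_be (k := k) (n := n) (by omega))).comp s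
      (hγ (k + 2) (by omega) hk)
    have ho : HasDerivAt (fun t => omz n l (k + 2) (γ t)) _ s := hx.sub ih
    simp only [yfb_succ hn hl hk]
    refine (((hasDerivAt_sgnPow (omz n l (k + 2) (γ s)) (one_lt_yexp hn (k + 1))).comp s
      ho).const_mul _).congr_deriv ?_
    simp only [dyfb]

theorem hasDerivAt_Wfb_succ (hn : 2 ≤ n) (hl : ∀ i, 0 < l i) {γ : ℝ → ℕ → ℝ} {s : ℝ}
    (hγ : ∀ i, 1 ≤ i → i < n → HasDerivAt (fun t => γ t i) (γ s (i + 1)) s) {k : ℕ} (hk : k < n)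
    {w : ℝ} (hw : HasDerivAt (fun t => γ t (k + 1)) w s) :
    HasDerivAt (fun t => Wfb n l (k + 1) (γ t)) (omz n l (k + 1) (γ s) * w -
      (γ s (k + 1) - vfb n l k (γ s)) * dyfb n l k (γ s)) s := by
  have hb := be_pos hn hk
  have hb' := inv_pos.2 hb
  have hy := hasDerivAt_yfb hn hl hγ hk
  have h1 := (hasDerivAt_abs_rpow_div (γ s (k + 1)) (by linarith : 1 < be n k + 1)).comp s hw
  have h2 := (hasDerivAt_abs_rpow_div (yfb n l k (γ s))
    (by linarith : 1 < (be n k)⁻¹ + 1)).comp s hy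
  simp only [Wfb_succ_eq_young hn hk]
  refine ((h1.add h2).sub (hw.mul hy)).congr_deriv ?_
  rw [add_sub_cancel_right, add_sub_cancel_right, sgnPow_yfb hn hk]
  simp only [omz]
  ring

theorem hasDerivAt_Vsum_succ (hn : 2 ≤ n) (hl : ∀ i, 0 < l i) {γ : ℝ → ℕ → ℝ} {s : ℝ}
    (hγ : ∀ i, 1 ≤ i → i < n → HasDerivAt (fun t => γ t i) (γ s (i + 1)) s) :
    ∀ {k : ℕ}, k < n → ∀ {w : ℝ}, HasDerivAt (fun t => γ t (k + 1)) w s →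
      HasDerivAt (fun t => Vsum n l (k + 1) (γ t))
        (drift n l (k + 1) (γ s) + omz n l (k + 1) (γ s) * w) s
  | 0, hk, w, hw => by
    simp only [Vsum, zero_add, Finset.sum_range_one]
    refine (hasDerivAt_Wfb_succ hn hl hγ hk hw).congr_deriv ?_
    simp [drift, omz, dyfb]
  | k + 1, hk, w, hw => by
    have ih := hasDerivAt_Vsum_succ hn hl hγ (k := k) (by omega) (hγ (k + 1) (by omega) hk)
    simp only [Vsum_succ (k + 1)]
    refine (ih.add (hasDerivAt_Wfb_succ hn hl hγ hk hw)).congr_deriv ?_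
    simp only [drift]
    ring

theorem contDiff_emb (i : ℕ) : ContDiff ℝ 1 fun z : Fin n → ℝ => emb n z i := by
  unfold emb
  split_ifs
  · exact contDiff_apply ℝ ℝ _
  · exact contDiff_const

theorem contDiff_yfb_emb (hn : 2 ≤ n) (hl : ∀ i, 0 < l i) :
    ∀ {k : ℕ}, k < n → ContDiff ℝ 1 fun z : Fin n → ℝ => yfb n l k (emb n z)
  | 0, _ => by simpa using contDiff_const
  | 1, _ => by
    simp only [yfb_one hn hl]
    exact contDiff_const.mul (contDiff_emb 1)
  | k + 2, hk => by
    have ih := contDiff_yfb_emb hn hl (k := k + 1) (by omega)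
    have ho : ContDiff ℝ 1 fun z : Fin n → ℝ => omz n l (k + 2) (emb n z) :=
      ((contDiff_sgnPow (one_lt_be (k := k) (n := n) (by omega))).comp (contDiff_emb (k + 2))).sub
        ih
    simp only [yfb_succ hn hl hk]
    exact contDiff_const.mul ((contDiff_sgnPow (one_lt_yexp hn (k + 1))).comp ho)

theorem contDiff_Vsum_emb (hn : 2 ≤ n) (hl : ∀ i, 0 < l i) :
    ContDiff ℝ 1 fun z : Fin n → ℝ => Vsum n l n (emb n z) := by
  refine ContDiff.sum fun k hk => ?_
  have hk' : k < n := Finset.mem_range.1 hk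
  have hb := be_pos hn hk'
  have hb' := inv_pos.2 hb
  have hy := contDiff_yfb_emb hn hl hk'
  have hx := contDiff_emb (n := n) (k + 1)
  simp only [Wfb_succ_eq_young hn hk']
  exact ((((contDiff_abs_rpow (by linarith)).comp hx).div_const _).add
    (((contDiff_abs_rpow (by linarith)).comp hy).div_const _)).sub (hx.mul hy)

theorem Vn_eq_Vsum (z : Fin n → ℝ) : Vn n l z = Vsum n l n (emb n z) := by
  rw [Vn, Vsum, Finset.range_eq_Ico, Finset.sum_Ico_add' (fun i => Wfb n l i (emb n z)) 0 n 1]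
  rfl

end

theorem emb_add_smul (n : ℕ) (z w : Fin n → ℝ) (t : ℝ) (i : ℕ) :
    emb n (z + t • w) i = emb n z i + t * emb n w i := by
  unfold emb
  split_ifs <;> simp

theorem emb_field_of_lt {n i : ℕ} (hi : 1 ≤ i) (hin : i < n) (z : Fin n → ℝ) (u : ℝ) :
    emb n (Jmat n *ᵥ z + u • eVec n n) i = emb n z (i + 1) := by
  have h1 : 1 ≤ i ∧ i ≤ n := ⟨hi, hin.le⟩
  have h2 : 1 ≤ i + 1 ∧ i + 1 ≤ n := ⟨by omega, hin⟩
  have h3 : ¬ i - 1 + 1 = n := by omega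
  have h4 : ∀ j : Fin n, i - 1 + 1 = (j : ℕ) ↔ j = ⟨i + 1 - 1, by omega⟩ := by
    intro j
    rw [Fin.ext_iff]
    simp only
    omega
  simp only [emb, dif_pos h1, dif_pos h2]
  simp [Jmat, eVec, h3, Matrix.mulVec, dotProduct, h4]

theorem emb_field_self {n : ℕ} (hn : 0 < n) (z : Fin n → ℝ) (u : ℝ) :
    emb n (Jmat n *ᵥ z + u • eVec n n) n = u := by
  have h1 : 1 ≤ n ∧ n ≤ n := ⟨hn, le_rfl⟩
  have h3 : n - 1 + 1 = n := by omega
  have h4 : ∀ j : Fin n, ¬ n = (j : ℕ) := by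
    intro j
    omega
  simp only [emb, dif_pos h1]
  simp [Jmat, eVec, Matrix.mulVec, dotProduct, h4, h3]

theorem fderiv_Vn {n : ℕ} (hn : 2 ≤ n) {l : ℕ → ℝ} (hl : ∀ i, 0 < l i) (z : Fin n → ℝ) (u : ℝ) :
    fderiv ℝ (Vn n l) z (Jmat n *ᵥ z + u • eVec n n) =
      drift n l n (emb n z) + omz n l n (emb n z) * u := by
  set w := Jmat n *ᵥ z + u • eVec n n with hw
  have hV : Vn n l = fun z => Vsum n l n (emb n z) := funext Vn_eq_Vsum
  have hcoord : ∀ i, HasDerivAt (fun t : ℝ => emb n (z + t • w) i) (emb n w i) 0 := by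
    intro i
    simp only [emb_add_smul]
    simpa using ((hasDerivAt_id (0 : ℝ)).mul_const (emb n w i)).const_add (emb n z i)
  have hγ : ∀ i, 1 ≤ i → i < n → HasDerivAt (fun t : ℝ => emb n (z + t • w) i)
      (emb n (z + (0 : ℝ) • w) (i + 1)) 0 := by
    intro i hi hin
    rw [zero_smul, add_zero, ← emb_field_of_lt hi hin z u]
    exact hcoord i
  obtain ⟨k, rfl⟩ : ∃ k, n = k + 1 := ⟨n - 1, by omega⟩
  have hlast := hcoord (k + 1)
  rw [hw, emb_field_self (by omega), ← hw] at hlast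
  have h1 := hasDerivAt_Vsum_succ hn hl hγ (k := k) (by omega) hlast
  have hdiff : HasFDerivAt (Vn (k + 1) l) (fderiv ℝ (Vn (k + 1) l) z) (z + (0 : ℝ) • w) := by
    rw [zero_smul, add_zero, hV]
    exact ((contDiff_Vsum_emb hn hl).differentiable one_ne_zero z).hasFDerivAt
  have hline : HasDerivAt (fun t : ℝ => z + t • w) w 0 := by
    simpa using ((hasDerivAt_id (0 : ℝ)).smul_const w).const_add z
  have h2 := hdiff.comp_hasDerivAt (0 : ℝ) hline
  have h3 : (Vn (k + 1) l ∘ fun t : ℝ => z + t • w) =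
      fun t => Vsum (k + 1) l (k + 1) (emb (k + 1) (z + t • w)) := by
    rw [hV]
    rfl
  rw [h3] at h2
  simpa using h2.unique h1

theorem omn_eq_omz {n : ℕ} (hn : 0 < n) (l : ℕ → ℝ) (z : Fin n → ℝ) :
    omn n l z = omz n l n (emb n z) := by
  obtain ⟨k, rfl⟩ : ∃ k, n = k + 1 := ⟨n - 1, by omega⟩
  rfl

/-- The case of a single integrator, where `V_1 = |x|` and `ω_1 = sign x`. -/
theorem key_Lyapunov_inequality_one :
    ∃ (l : ℕ → ℝ) (c : ℝ), (∀ i, 0 < l i) ∧ 0 < c ∧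
      ContDiffOn ℝ 1 (Vn 1 l) {(0 : Fin 1 → ℝ)}ᶜ ∧
      ∀ x : Fin 1 → ℝ, x ≠ 0 → ∀ u s : ℝ, s ∈ Set.Icc (-1 : ℝ) 1 →
        (omn 1 l x ≠ 0 → s = Real.sign (omn 1 l x)) →
        fderiv ℝ (Vn 1 l) x ((Jmat 1) *ᵥ x + u • eVec 1 1) ≤
          -c * Vn 1 l x ^ al 1 + omn 1 l x * (u + l 1 * s) := by
  have hbe : be 1 0 = 0 := by
    simp [be, pe]
    norm_num
  have hV : Vn 1 (fun _ => 1) = fun x : Fin 1 → ℝ => |x 0| := by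
    funext x
    simp [Vn, Wfb, emb, vfb, hbe]
  have hne : ∀ x : Fin 1 → ℝ, x ≠ 0 → x 0 ≠ 0 := fun x hx h0 => hx (by
    funext i
    rw [Subsingleton.elim i 0, h0]
    rfl)
  refine ⟨fun _ => 1, 1, fun _ => one_pos, one_pos, ?_, ?_⟩
  · rw [hV]
    exact fun x hx => ((contDiffAt_abs (hne x hx)).comp x
      (contDiff_apply ℝ ℝ (0 : Fin 1)).contDiffAt).contDiffWithinAt
  · intro x hx u s _ hs
    have hx0 := hne x hx
    have hom : omn 1 (fun _ => 1) x = Real.sign (x 0) := by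
      simp [omn, omfb, emb, vfb, hbe, sgnPow]
    have hfd : HasFDerivAt (Vn 1 fun _ => 1)
        ((SignType.sign (x 0) : ℝ) • (ContinuousLinearMap.proj 0 : (Fin 1 → ℝ) →L[ℝ] ℝ)) x := by
      rw [hV]
      exact (hasDerivAt_abs hx0).comp_hasFDerivAt x
        (ContinuousLinearMap.proj (R := ℝ) (φ := fun _ : Fin 1 => ℝ) 0).hasFDerivAt
    have hal : al 1 = 0 := by simp [al]
    rw [hfd.fderiv, hV, hal, Real.rpow_zero]
    rw [hom] at hs ⊢
    rw [hs (by rwa [Ne, Real.sign_eq_zero_iff])]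
    rcases lt_or_gt_of_ne hx0 with h | h
    · simp [Jmat, eVec, Matrix.mulVec, dotProduct, Real.sign_of_neg h, sign_neg h,
        Real.sign_of_neg neg_one_lt_zero]
    · simp [Jmat, eVec, Matrix.mulVec, dotProduct, Real.sign_of_pos h, sign_pos h]

/-- there exist positive gains `l_1,…,l_n` and `c_n > 0` such that `V_n`
is `C¹` away from the origin and, for every `x ≠ 0`, `u ∈ ℝ` and `s ∈ [-1,1]` with
`s = sign(ω_n(x))` whenever `ω_n(x) ≠ 0`,
`∇V_n(x)·(J_n x + e_n u) ≤ -c_n V_n(x)^α + ω_n(x)(u + l_n s)`. -/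
theorem key_Lyapunov_inequality (n : ℕ) (hn : 0 < n) :
    ∃ (l : ℕ → ℝ) (c : ℝ), (∀ i, 0 < l i) ∧ 0 < c ∧
      ContDiffOn ℝ 1 (Vn n l) {(0 : Fin n → ℝ)}ᶜ ∧
      ∀ x : Fin n → ℝ, x ≠ 0 → ∀ u s : ℝ, s ∈ Set.Icc (-1 : ℝ) 1 →
        (omn n l x ≠ 0 → s = Real.sign (omn n l x)) →
        fderiv ℝ (Vn n l) x ((Jmat n) *ᵥ x + u • eVec n n) ≤
          -c * Vn n l x ^ al n + omn n l x * (u + l n * s) := by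
  obtain rfl | hn2 : n = 1 ∨ 2 ≤ n := by omega
  · exact key_Lyapunov_inequality_one
  obtain ⟨l, hl, c, hc, hle⟩ := exists_gains hn2 le_rfl
  refine ⟨l, c, hl, hc, ?_, fun x _ u s _ hs => ?_⟩
  · rw [funext Vn_eq_Vsum]
    exact (contDiff_Vsum_emb hn2 hl).contDiffOn
  · have h1 := hle (emb n x)
    rw [fderiv_Vn hn2 hl, Vn_eq_Vsum, omn_eq_omz hn]
    rw [omn_eq_omz hn] at hs
    set ω := omz n l n (emb n x) with hω
    have h2 : ω * vfb n l n (emb n x) = -l n * |ω| := by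
      obtain ⟨k, rfl⟩ : ∃ k, n = k + 1 := ⟨n - 1, by omega⟩
      have h := omz_mul_vfb_succ (l := l) hn2 (Nat.lt_succ_self k) (emb (k + 1) x)
      rw [vexp_eq hn2 (Nat.lt_succ_self k)] at h
      simpa [← hω] using h
    have h3 : ω * s = |ω| := by
      rcases lt_trichotomy ω 0 with h | h | h
      · rw [hs h.ne, Real.sign_of_neg h, abs_of_neg h, mul_neg_one]
      · simp [h]
      · rw [hs h.ne', Real.sign_of_pos h, abs_of_pos h, mul_one]
    have h4 : ω * (u + l n * s) = ω * u + l n * |ω| := by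
      rw [← h3]
      ring
    rw [h4]
    linarith
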